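/- arXiv:1303.3718 — 2 statements merged into one kernel-verified Lean document; each statement's English description precedes it below -/
import Mathlib

section
/- Let (A_i)_{i ∈ I} be a family of small categories, let i₀ ∈ I, and let C = Σ_{i ∈ I} A_i be their disjoint-union (sigma) category, pointed at an object pt of A_{i₀} (so that A_{i₀} is pointed at pt). Then U[C] is isomorphic, as a monoid, to the coproduct (free product) of U[A_{i₀}] with the monoids U(A_i) for i ≠ i₀. -/
open CategoryTheory

/-- The set of all morphisms of a small category `C`. -/
abbrev Mor (C : Type) [SmallCategory C] : Type := Σ x y : C, x ⟶ y

/-- The generating relations for the universal monoid `U(C)` on a small category `C`: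
the identity `id_x` of each object is related to `1`, and the composite `g ∘ f` of a
composable pair `f : x → y`, `g : y → z` is related to the product `f·g`. -/
def uRel (C : Type) [SmallCategory C] :
    FreeMonoid (Mor C) → FreeMonoid (Mor C) → Prop := fun a b =>
  (∃ x : C, a = FreeMonoid.of ⟨x, x, 𝟙 x⟩ ∧ b = 1) ∨
  (∃ (x y z : C) (f : x ⟶ y) (g : y ⟶ z),
    a = FreeMonoid.of ⟨x, z, f ≫ g⟩ ∧
    b = FreeMonoid.of ⟨x, y, f⟩ * FreeMonoid.of ⟨y, z, g⟩)

/-- The universal monoid `U(C)` of a small category `C`: the quotient of the free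
monoid on the set of all morphisms of `C` by the monoid congruence generated by the
relations `id_x ~ 1` and `(g ∘ f) ~ f·g`. -/
abbrev UMon (C : Type) [SmallCategory C] : Type := (conGen (uRel C)).Quotient

/-- The class `⟦f⟧` in `U(C)` of a morphism `f` of `C`. -/
def UMon.mk {C : Type} [SmallCategory C] {x y : C} (f : x ⟶ y) : UMon C :=
  (conGen (uRel C)).mk' (FreeMonoid.of ⟨x, y, f⟩)

/-- The generating relations for the reduced universal monoid `U[C]` of a pointed
category `(C, pt)`: in addition to the relations of `U(C)`, every endomorphism of the
basepoint `pt` is related to `1`. -/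
def uRedRel (C : Type) [SmallCategory C] (pt : C) :
    FreeMonoid (Mor C) → FreeMonoid (Mor C) → Prop := fun a b =>
  uRel C a b ∨ (∃ e : pt ⟶ pt, a = FreeMonoid.of ⟨pt, pt, e⟩ ∧ b = 1)

/-- The reduced universal monoid `U[C]` of a pointed category `(C, pt)`: the quotient
of the free monoid on the morphisms of `C` by the monoid congruence generated by the
relations `id_x ~ 1`, `(g ∘ f) ~ f·g`, and `e ~ 1` for every endomorphism `e` of `pt`. -/
abbrev URed (C : Type) [SmallCategory C] (pt : C) : Type := (conGen (uRedRel C pt)).Quotient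

/-- The class `⟦f⟧` in `U[C]` of a morphism `f` of `C`. -/
def URed.mk {C : Type} [SmallCategory C] (pt : C) {x y : C} (f : x ⟶ y) : URed C pt :=
  (conGen (uRedRel C pt)).mk' (FreeMonoid.of ⟨x, y, f⟩)

namespace UMon

variable {C : Type} [SmallCategory C] {M : Type} [Monoid M]

theorem mk_id (x : C) : UMon.mk (𝟙 x) = 1 :=
  (Con.eq _).2 (ConGen.Rel.of _ _ (Or.inl ⟨x, rfl, rfl⟩))

theorem mk_comp {x y z : C} (f : x ⟶ y) (g : y ⟶ z) :
    UMon.mk (f ≫ g) = UMon.mk f * UMon.mk g :=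
  (Con.eq _).2 (ConGen.Rel.of _ _ (Or.inr ⟨x, y, z, f, g, rfl, rfl⟩))

/-- A map on morphisms which sends identities to `1` and composites to products
extends to the universal monoid. -/
def lift (φ : ∀ x y : C, (x ⟶ y) → M) (hid : ∀ x : C, φ x x (𝟙 x) = 1)
    (hcomp : ∀ (x y z : C) (f : x ⟶ y) (g : y ⟶ z), φ x z (f ≫ g) = φ x y f * φ y z g) :
    UMon C →* M :=
  Con.lift _ (FreeMonoid.lift fun m : Mor C => φ m.1 m.2.1 m.2.2) <| Con.conGen_le.2 <| by
    rintro _ _ (⟨x, rfl, rfl⟩ | ⟨x, y, z, f, g, rfl, rfl⟩)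
    · simpa [Con.ker_rel] using hid x
    · simpa [Con.ker_rel] using hcomp x y z f g

@[simp]
theorem lift_mk (φ : ∀ x y : C, (x ⟶ y) → M) (hid : ∀ x : C, φ x x (𝟙 x) = 1)
    (hcomp : ∀ (x y z : C) (f : x ⟶ y) (g : y ⟶ z), φ x z (f ≫ g) = φ x y f * φ y z g)
    {x y : C} (f : x ⟶ y) : lift φ hid hcomp (UMon.mk f) = φ x y f := by
  simp [lift, UMon.mk]

theorem hom_ext {F G : UMon C →* M}
    (h : ∀ {x y : C} (f : x ⟶ y), F (UMon.mk f) = G (UMon.mk f)) : F = G :=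
  Con.hom_ext <| FreeMonoid.hom_eq fun m => h m.2.2

end UMon

namespace URed

variable {C : Type} [SmallCategory C] {pt : C} {M : Type} [Monoid M]

theorem mk_id (x : C) : URed.mk pt (𝟙 x) = 1 :=
  (Con.eq _).2 (ConGen.Rel.of _ _ (Or.inl (Or.inl ⟨x, rfl, rfl⟩)))

theorem mk_comp {x y z : C} (f : x ⟶ y) (g : y ⟶ z) :
    URed.mk pt (f ≫ g) = URed.mk pt f * URed.mk pt g :=
  (Con.eq _).2 (ConGen.Rel.of _ _ (Or.inl (Or.inr ⟨x, y, z, f, g, rfl, rfl⟩)))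

theorem mk_end (e : pt ⟶ pt) : URed.mk pt e = 1 :=
  (Con.eq _).2 (ConGen.Rel.of _ _ (Or.inr ⟨e, rfl, rfl⟩))

/-- A map on morphisms which sends identities and endomorphisms of the basepoint to `1`
and composites to products extends to the reduced universal monoid. -/
def lift (φ : ∀ x y : C, (x ⟶ y) → M) (hid : ∀ x : C, φ x x (𝟙 x) = 1)
    (hcomp : ∀ (x y z : C) (f : x ⟶ y) (g : y ⟶ z), φ x z (f ≫ g) = φ x y f * φ y z g)
    (hend : ∀ e : pt ⟶ pt, φ pt pt e = 1) : URed C pt →* M :=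
  Con.lift _ (FreeMonoid.lift fun m : Mor C => φ m.1 m.2.1 m.2.2) <| Con.conGen_le.2 <| by
    rintro _ _ ((⟨x, rfl, rfl⟩ | ⟨x, y, z, f, g, rfl, rfl⟩) | ⟨e, rfl, rfl⟩)
    · simpa [Con.ker_rel] using hid x
    · simpa [Con.ker_rel] using hcomp x y z f g
    · simpa [Con.ker_rel] using hend e

@[simp]
theorem lift_mk (φ : ∀ x y : C, (x ⟶ y) → M) (hid : ∀ x : C, φ x x (𝟙 x) = 1)
    (hcomp : ∀ (x y z : C) (f : x ⟶ y) (g : y ⟶ z), φ x z (f ≫ g) = φ x y f * φ y z g)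
    (hend : ∀ e : pt ⟶ pt, φ pt pt e = 1) {x y : C} (f : x ⟶ y) :
    lift φ hid hcomp hend (URed.mk pt f) = φ x y f := by
  simp [lift, URed.mk]

theorem hom_ext {F G : URed C pt →* M}
    (h : ∀ {x y : C} (f : x ⟶ y), F (URed.mk pt f) = G (URed.mk pt f)) : F = G :=
  Con.hom_ext <| FreeMonoid.hom_eq fun m => h m.2.2

/-- The quotient map from the universal monoid to the reduced universal monoid. -/
def ofUMon (C : Type) [SmallCategory C] (pt : C) : UMon C →* URed C pt :=
  UMon.lift (fun _ _ => URed.mk pt) mk_id (fun _ _ _ => mk_comp)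

@[simp]
theorem ofUMon_mk {x y : C} (f : x ⟶ y) : ofUMon C pt (UMon.mk f) = URed.mk pt f :=
  UMon.lift_mk _ _ _ f

section Sigma

variable {I : Type} {A : I → Type} [∀ i, SmallCategory (A i)]

/-- The class in the reduced universal monoid of the sigma category of a morphism of a
component. -/
def sigmaMk (p : Σ i, A i) {i : I} {x y : A i} (f : x ⟶ y) : URed (Σ i, A i) p :=
  URed.mk p (x := ⟨i, x⟩) (y := ⟨i, y⟩) (Sigma.SigmaHom.mk f)

theorem sigmaMk_id (p : Σ i, A i) {i : I} (x : A i) : sigmaMk p (𝟙 x) = 1 :=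
  mk_id (⟨i, x⟩ : Σ i, A i)

theorem sigmaMk_comp (p : Σ i, A i) {i : I} {x y z : A i} (f : x ⟶ y) (g : y ⟶ z) :
    sigmaMk p (f ≫ g) = sigmaMk p f * sigmaMk p g :=
  mk_comp (x := (⟨i, x⟩ : Σ i, A i)) (y := ⟨i, y⟩) (z := ⟨i, z⟩)
    (Sigma.SigmaHom.mk f) (Sigma.SigmaHom.mk g)

theorem sigmaMk_end {i₀ : I} {pt : A i₀} (e : pt ⟶ pt) : sigmaMk ⟨i₀, pt⟩ e = 1 :=
  mk_end (pt := (⟨i₀, pt⟩ : Σ i, A i)) (Sigma.SigmaHom.mk e)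

/-- Homomorphisms out of the universal monoids of the components which kill the
endomorphisms of the basepoint glue to the reduced universal monoid of the sigma category. -/
def sigmaDesc {i₀ : I} {pt : A i₀} (ι : ∀ i, UMon (A i) →* M)
    (hend : ∀ e : pt ⟶ pt, ι i₀ (UMon.mk e) = 1) : URed (Σ i, A i) ⟨i₀, pt⟩ →* M :=
  lift (fun _ _ f => match f with | Sigma.SigmaHom.mk (i := i) f => ι i (UMon.mk f))
    (fun ⟨i, x⟩ => (congrArg (ι i) (UMon.mk_id x)).trans (map_one _))
    (by rintro _ _ _ ⟨f⟩ ⟨g⟩; exact (congrArg (ι _) (UMon.mk_comp f g)).trans (map_mul (ι _) _ _))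
    (by rintro ⟨e⟩; exact hend e)

@[simp]
theorem sigmaDesc_mk {i₀ : I} {pt : A i₀} (ι : ∀ i, UMon (A i) →* M)
    (hend : ∀ e : pt ⟶ pt, ι i₀ (UMon.mk e) = 1) {i : I} {x y : A i} (f : x ⟶ y) :
    sigmaDesc ι hend (sigmaMk _ f) = ι i (UMon.mk f) :=
  lift_mk _ _ _ _ _

theorem sigma_hom_ext {p : Σ i, A i} {F G : URed (Σ i, A i) p →* M}
    (h : ∀ (i : I) {x y : A i} (f : x ⟶ y),
      F (sigmaMk p f) = G (sigmaMk p f)) :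
    F = G :=
  hom_ext <| by rintro _ _ ⟨f⟩; exact h _ f

/-- The homomorphism induced by the inclusion of a component in the sigma category. -/
def sigmaIncl (p : Σ i, A i) (i : I) : UMon (A i) →* URed (Σ i, A i) p :=
  UMon.lift (fun _ _ => sigmaMk p) (sigmaMk_id _) (fun _ _ _ => sigmaMk_comp _)

@[simp]
theorem sigmaIncl_mk (p : Σ i, A i) {i : I} {x y : A i} (f : x ⟶ y) :
    sigmaIncl p i (UMon.mk f) = sigmaMk p f :=
  UMon.lift_mk _ _ _ f

/-- The homomorphism of reduced universal monoids induced by the inclusion of the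
component of the basepoint in the sigma category. -/
def sigmaInclBase (i₀ : I) (pt : A i₀) : URed (A i₀) pt →* URed (Σ i, A i) ⟨i₀, pt⟩ :=
  lift (fun _ _ => sigmaMk _) (sigmaMk_id _) (fun _ _ _ => sigmaMk_comp _) sigmaMk_end

@[simp]
theorem sigmaInclBase_mk {i₀ : I} {pt x y : A i₀} (f : x ⟶ y) :
    sigmaInclBase i₀ pt (URed.mk pt f) = sigmaMk ⟨i₀, pt⟩ f :=
  lift_mk _ _ _ _ f

open Classical in
/-- The homomorphism from the universal monoid of a component to the free product of
`U[A i₀]` with the `U(A i)` for `i ≠ i₀`. -/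
noncomputable def toCoprod (i₀ : I) (pt : A i₀) (i : I) : UMon (A i) →*
    Monoid.Coprod (URed (A i₀) pt) (Monoid.CoprodI fun i : {i : I // i ≠ i₀} => UMon (A i)) :=
  if h : i = i₀ then
    (Monoid.Coprod.inl.comp (ofUMon (A i₀) pt)).comp (h ▸ MonoidHom.id (UMon (A i)))
  else Monoid.Coprod.inr.comp
    (Monoid.CoprodI.of (M := fun i : {i : I // i ≠ i₀} => UMon (A i)) (i := ⟨i, h⟩))

@[simp]
theorem toCoprod_self (i₀ : I) (pt : A i₀) :
    toCoprod i₀ pt i₀ = Monoid.Coprod.inl.comp (ofUMon (A i₀) pt) :=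
  dif_pos rfl

theorem toCoprod_of_ne {i₀ : I} (pt : A i₀) {i : I} (h : i ≠ i₀) :
    toCoprod i₀ pt i = Monoid.Coprod.inr.comp
      (Monoid.CoprodI.of (M := fun i : {i : I // i ≠ i₀} => UMon (A i)) (i := ⟨i, h⟩)) :=
  dif_neg h

end Sigma

end URed

/-- Let `(A i)` be a family of small categories, `i₀` an index, and `pt` an object of
`A i₀`.  Then the reduced universal monoid of the sigma category `Σ i, A i`, pointed
at `⟨i₀, pt⟩`, is isomorphic, as a monoid, to the coproduct (free product) of the
reduced universal monoid `U[A i₀]` with the monoids `U(A i)` for `i ≠ i₀`. -/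
theorem uRed_sigma_iso_coprod (I : Type) (A : I → Type) [∀ i, SmallCategory (A i)]
    (i₀ : I) (pt : A i₀) :
    Nonempty (URed (Σ i, A i) ⟨i₀, pt⟩ ≃*
      Monoid.Coprod (URed (A i₀) pt) (Monoid.CoprodI fun i : {i : I // i ≠ i₀} => UMon (A i))) := by
  refine ⟨MonoidHom.toMulEquiv
    (URed.sigmaDesc (URed.toCoprod i₀ pt) fun e => by simp [URed.mk_end])
    (Monoid.Coprod.lift (URed.sigmaInclBase i₀ pt)
      (Monoid.CoprodI.lift fun i => URed.sigmaIncl _ i.1)) ?_ ?_⟩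
  · refine URed.sigma_hom_ext fun i x y f => ?_
    by_cases h : i = i₀
    · subst h
      simp
    · simp [URed.toCoprod_of_ne pt h]
  · refine Monoid.Coprod.hom_ext (URed.hom_ext fun f => ?_)
      (Monoid.CoprodI.ext_hom _ _ fun i => UMon.hom_ext fun f => ?_)
    · simp
    · simp [URed.toCoprod_of_ne pt i.2]
end

section
/- Let G be a group with a right action on a pointed set X that fixes the basepoint pt. Then every element of the reduced universal monoid U[X//G] of the pointed action category X//G is invertible; that is, U[X//G] is a group. -/
open CategoryTheory

/-- A right action of a monoid `M` on a type `X`. -/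
class RightAction (M X : Type) [Monoid M] where
  act : X → M → X
  act_one : ∀ x : X, act x 1 = x
  act_mul : ∀ (x : X) (m k : M), act (act x m) k = act x (m * k)

/-- The action category `X // M` of a right action of a monoid `M` on `X`:
objects are the elements of `X`, and a morphism `x ⟶ y` is an element `m : M`
with `y = x · m`. -/
structure ActionCat (M X : Type) [Monoid M] [RightAction M X] where
  obj : X

instance (M X : Type) [Monoid M] [RightAction M X] : Category (ActionCat M X) where
  Hom a b := { m : M // RightAction.act a.obj m = b.obj }
  id a := ⟨1, RightAction.act_one a.obj⟩
  comp f g := ⟨f.1 * g.1, by rw [← RightAction.act_mul, f.2, g.2]⟩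
  id_comp f := Subtype.ext (one_mul _)
  comp_id f := Subtype.ext (mul_one _)
  assoc f g h := Subtype.ext (mul_assoc _ _ _)



theorem URed.mk_id_s13 {C : Type} [SmallCategory C] (pt x : C) : URed.mk pt (𝟙 x) = 1 :=
  (Con.eq _).2 (ConGen.Rel.of _ _ (Or.inl (Or.inl ⟨x, rfl, rfl⟩)))

theorem URed.mk_comp_s13 {C : Type} [SmallCategory C] (pt : C) {x y z : C} (f : x ⟶ y) (g : y ⟶ z) :
    URed.mk pt (f ≫ g) = URed.mk pt f * URed.mk pt g :=
  (Con.eq _).2 (ConGen.Rel.of _ _ (Or.inl (Or.inr ⟨x, y, z, f, g, rfl, rfl⟩)))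

theorem URed.isUnit_mk {C : Type} [SmallCategory C] (pt : C) {x y : C} (f : x ⟶ y) [IsIso f] :
    IsUnit (URed.mk pt f) :=
  ⟨⟨URed.mk pt f, URed.mk pt (inv f),
    by rw [← URed.mk_comp_s13, IsIso.hom_inv_id, URed.mk_id_s13],
    by rw [← URed.mk_comp_s13, IsIso.inv_hom_id, URed.mk_id_s13]⟩, rfl⟩

/-- In a pointed groupoid, every element of the reduced universal monoid is invertible. -/
theorem URed.isUnit_of_forall_isIso {C : Type} [SmallCategory C] (pt : C)
    (h : ∀ {x y : C} (f : x ⟶ y), IsIso f) (u : URed C pt) : IsUnit u := by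
  obtain ⟨w, rfl⟩ := Con.mk'_surjective u
  induction w using FreeMonoid.recOn with
  | one => rw [map_one]; exact isUnit_one
  | of_mul m w ih =>
    obtain ⟨x, y, f⟩ := m
    have := h f
    rw [map_mul]
    exact (URed.isUnit_mk pt f).mul ih

theorem ActionCat.isIso_hom {G X : Type} [Group G] [RightAction G X] {a b : ActionCat G X}
    (f : a ⟶ b) : IsIso f :=
  ⟨⟨f.1⁻¹, (congrArg (RightAction.act · f.1⁻¹) f.2).symm.trans
      (by rw [RightAction.act_mul, mul_inv_cancel, RightAction.act_one])⟩,
    Subtype.ext (mul_inv_cancel f.1), Subtype.ext (inv_mul_cancel f.1)⟩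

/-- Let `G` be a group with a right action on a pointed type `X` fixing the basepoint
`pt`.  Then every element of the reduced universal monoid `U[X // G]` of the pointed
action category `X // G` is invertible; that is, `U[X // G]` is a group. -/
theorem uRed_actionCat_isUnit (G X : Type) [Group G] [RightAction G X]
    (pt : X) (hpt : ∀ g : G, RightAction.act pt g = pt)
    (u : URed (ActionCat G X) ⟨pt⟩) : IsUnit u := by
  exact URed.isUnit_of_forall_isIso _ ActionCat.isIso_hom u
end
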